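/- arXiv:1801.09099 — 2 statements merged into one kernel-verified Lean document; each statement's English description precedes it below -/
import Mathlib

section
/- For all real numbers a, b, every integer n ≥ 0, and every real x: (a+b+n+1)·P_n^{(a,b)}(x) + (1+x)·(d/dx)P_n^{(a,b)}(x) = (n+a+b+1)·P_n^{(a+1,b)}(x), and (2a + (1−x)n)·P_n^{(a,b)}(x) − (1−x^2)·(d/dx)P_n^{(a,b)}(x) = 2(n+a)·P_n^{(a−1,b)}(x). -/
noncomputable section

/-- Generalized binomial coefficient `C(α, j) = α(α−1)⋯(α−j+1)/j!`. -/
def genBinom (α : ℝ) (j : ℕ) : ℝ :=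
  (∏ i ∈ Finset.range j, (α - i)) / (Nat.factorial j)

/-- Jacobi polynomial `P_n^{(a,b)}(x)`; zero for negative `n`. -/
def jacobiP (n : ℤ) (a b : ℝ) (x : ℝ) : ℝ :=
  if n < 0 then 0 else
    ∑ m ∈ Finset.range (n.toNat + 1),
      genBinom ((n : ℝ) + a) (n.toNat - m) * genBinom ((n : ℝ) + b) m *
        ((x - 1) / 2) ^ m * ((x + 1) / 2) ^ (n.toNat - m)

theorem genBinom_zero (α : ℝ) : genBinom α 0 = 1 := by simp [genBinom]

theorem succ_mul_genBinom_succ (α : ℝ) (j : ℕ) :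
    ((j : ℝ) + 1) * genBinom α (j + 1) = (α - j) * genBinom α j := by
  have h : (Nat.factorial j : ℝ) ≠ 0 := by exact_mod_cast Nat.factorial_ne_zero j
  have h' : (j : ℝ) + 1 ≠ 0 := by positivity
  simp only [genBinom, Finset.prod_range_succ, Nat.factorial_succ, Nat.cast_mul, Nat.cast_succ]
  field_simp

theorem genBinom_add_one_succ (α : ℝ) (j : ℕ) :
    genBinom (α + 1) (j + 1) = genBinom α (j + 1) + genBinom α j := by
  induction j with
  | zero => simp [genBinom]
  | succ j ih =>
    have h₁ := succ_mul_genBinom_succ (α + 1) (j + 1)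
    have h₂ := succ_mul_genBinom_succ α (j + 1)
    have h₃ := succ_mul_genBinom_succ α j
    have h : (j : ℝ) + 1 + 1 ≠ 0 := by positivity
    push_cast at h₁ h₂
    apply mul_left_cancel₀ h
    rw [ih] at h₁
    linear_combination h₁ - h₂ - h₃

theorem mul_genBinom_sub_one (α : ℝ) (j : ℕ) :
    α * genBinom (α - 1) j = (α - j) * genBinom α j := by
  induction j with
  | zero => simp [genBinom]
  | succ j ih =>
    have h₁ := succ_mul_genBinom_succ (α - 1) j
    have h₂ := succ_mul_genBinom_succ α j
    have h : (j : ℝ) + 1 ≠ 0 := by positivity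
    apply mul_left_cancel₀ h
    push_cast
    linear_combination α * h₁ + (α - 1 - j) * ih - (α - j - 1) * h₂

theorem jacobiP_natCast (n : ℕ) (a b x : ℝ) :
    jacobiP n a b x = ∑ m ∈ Finset.range (n + 1),
      genBinom (n + a) (n - m) * genBinom (n + b) m *
        ((x - 1) / 2) ^ m * ((x + 1) / 2) ^ (n - m) := by
  simp [jacobiP]

theorem deriv_jacobiP_natCast (n : ℕ) (a b x : ℝ) :
    deriv (jacobiP n a b) x = ∑ m ∈ Finset.range (n + 1),
      genBinom (n + a) (n - m) * genBinom (n + b) m *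
        ((m * ((x - 1) / 2) ^ (m - 1) * (1 / 2)) * ((x + 1) / 2) ^ (n - m) +
          ((x - 1) / 2) ^ m * ((n - m : ℕ) * ((x + 1) / 2) ^ (n - m - 1) * (1 / 2))) := by
  rw [funext (jacobiP_natCast n a b)]
  refine (HasDerivAt.fun_sum fun m _ => ?_).deriv
  have hu : HasDerivAt (fun y : ℝ => (y - 1) / 2) (1 / 2) x :=
    ((hasDerivAt_id x).sub_const 1).div_const 2
  have hv : HasDerivAt (fun y : ℝ => (y + 1) / 2) (1 / 2) x :=
    ((hasDerivAt_id x).add_const 1).div_const 2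
  simp only [mul_assoc (genBinom (n + a) (n - m) * genBinom (n + b) m)]
  simpa only [mul_assoc] using ((hu.fun_pow m).fun_mul (hv.fun_pow (n - m))).const_mul
    (genBinom (n + a) (n - m) * genBinom (n + b) m)

theorem natCast_mul_pow_pred_mul (y : ℝ) (k : ℕ) : (k : ℝ) * y ^ (k - 1) * y = k * y ^ k := by
  cases k with
  | zero => simp
  | succ k => simp [pow_succ, mul_assoc]

theorem jacobiP_natCast_sub_one (n : ℕ) (a b x : ℝ) :
    (2 * a + (1 - x) * n) * jacobiP n a b x - (1 - x ^ 2) * deriv (jacobiP n a b) x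
      = 2 * (n + a) * jacobiP n (a - 1) b x := by
  rw [deriv_jacobiP_natCast, jacobiP_natCast, jacobiP_natCast, Finset.mul_sum, Finset.mul_sum,
    Finset.mul_sum, ← Finset.sum_sub_distrib]
  refine Finset.sum_congr rfl fun m hm => ?_
  have hmn : m ≤ n := Nat.lt_succ_iff.mp (Finset.mem_range.mp hm)
  have h := mul_genBinom_sub_one (n + a) (n - m)
  have hu := natCast_mul_pow_pred_mul ((x - 1) / 2) m
  have hv := natCast_mul_pow_pred_mul ((x + 1) / 2) (n - m)
  rw [show (n : ℝ) + (a - 1) = n + a - 1 by ring]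
  rw [Nat.cast_sub hmn] at h hv ⊢
  generalize genBinom (n + a - 1) (n - m) = g at *
  generalize genBinom (n + a) (n - m) = c at *
  generalize genBinom (n + b) m = d at *
  generalize ((x - 1) / 2) ^ (m - 1) = u' at *
  generalize ((x + 1) / 2) ^ (n - m - 1) = v' at *
  generalize ((x - 1) / 2) ^ m = u at *
  generalize ((x + 1) / 2) ^ (n - m) = v at *
  linear_combination (-2 * d * u * v) * h + (c * d * v * (x + 1)) * hu
    + (c * d * u * (x - 1)) * hv

/-- The coefficient identity behind the ladder relation raising the first parameter. -/
theorem genBinom_ladder (A B : ℝ) (m k : ℕ) :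
    (A + B + 1 - m) * (genBinom A (k + 1) * genBinom B m)
        + (m + 1) * (genBinom A k * genBinom B (m + 1))
      = (A + B + 1 - (m + k + 1)) * (genBinom (A + 1) (k + 1) * genBinom B m) := by
  have h₁ := succ_mul_genBinom_succ B m
  have h₂ := succ_mul_genBinom_succ A k
  rw [genBinom_add_one_succ]
  linear_combination genBinom A k * h₁ + genBinom B m * h₂

theorem jacobiP_natCast_add_one (n : ℕ) (a b x : ℝ) :
    (a + b + n + 1) * jacobiP n a b x + (1 + x) * deriv (jacobiP n a b) x
      = (n + a + b + 1) * jacobiP n (a + 1) b x := by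
  set u := (x - 1) / 2 with hu
  set v := (x + 1) / 2 with hv
  let c : ℕ → ℝ := fun m => genBinom (n + a) (n - m) * genBinom (n + b) m
  have key : (a + b + n + 1) * jacobiP n a b x + (1 + x) * deriv (jacobiP n a b) x
      = ∑ m ∈ Finset.range (n + 1), (a + b + 2 * n + 1 - m) * c m * (u ^ m * v ^ (n - m))
        + ∑ m ∈ Finset.range (n + 1), m * c m * (u ^ (m - 1) * (v ^ (n - m) * v)) := by
    rw [deriv_jacobiP_natCast, jacobiP_natCast, Finset.mul_sum, Finset.mul_sum,
      ← Finset.sum_add_distrib, ← Finset.sum_add_distrib]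
    refine Finset.sum_congr rfl fun m hm => ?_
    have hmn : m ≤ n := Nat.lt_succ_iff.mp (Finset.mem_range.mp hm)
    have h := natCast_mul_pow_pred_mul v (n - m)
    rw [Nat.cast_sub hmn] at h ⊢
    simp only [← hu, ← hv, c]
    rw [show 1 + x = 2 * v by rw [hv]; ring]
    linear_combination genBinom (n + a) (n - m) * genBinom (n + b) m * u ^ m * h
  rw [key, Finset.sum_range_succ, Finset.sum_range_succ' (fun m => _ * c m * (u ^ (m - 1) * _)),
    jacobiP_natCast, Finset.mul_sum, Finset.sum_range_succ (fun m => _ * (_ * _ * _ * _))]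
  have hsum : ∑ m ∈ Finset.range n, (a + b + 2 * n + 1 - m) * c m * (u ^ m * v ^ (n - m))
      + ∑ m ∈ Finset.range n, ((m + 1 : ℕ) : ℝ) * c (m + 1) *
          (u ^ (m + 1 - 1) * (v ^ (n - (m + 1)) * v))
      = ∑ m ∈ Finset.range n, (n + a + b + 1) *
          (genBinom (n + (a + 1)) (n - m) * genBinom (n + b) m * u ^ m * v ^ (n - m)) := by
    rw [← Finset.sum_add_distrib]
    refine Finset.sum_congr rfl fun m hm => ?_
    obtain ⟨k, rfl⟩ : ∃ k, n = m + k + 1 :=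
      ⟨n - m - 1, by have := Finset.mem_range.mp hm; omega⟩
    have h := genBinom_ladder (((m + k + 1 : ℕ) : ℝ) + a) (((m + k + 1 : ℕ) : ℝ) + b) m k
    simp only [c, show m + k + 1 - m = k + 1 by omega, show m + k + 1 - (m + 1) = k by omega,
      Nat.add_sub_cancel, ← add_assoc] at h ⊢
    push_cast at h ⊢
    linear_combination (u ^ m * v ^ (k + 1)) * h
  rw [← hsum]
  simp only [c, Nat.sub_self, genBinom_zero, ← hu, ← hv]
  push_cast
  ring

theorem jacobi_ladder_L2 (a b : ℝ) (n : ℤ) (hn : 0 ≤ n) (x : ℝ) :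
    (a + b + (n : ℝ) + 1) * jacobiP n a b x + (1 + x) * deriv (jacobiP n a b) x
      = ((n : ℝ) + a + b + 1) * jacobiP n (a + 1) b x ∧
    (2 * a + (1 - x) * (n : ℝ)) * jacobiP n a b x
        - (1 - x ^ 2) * deriv (jacobiP n a b) x
      = 2 * ((n : ℝ) + a) * jacobiP n (a - 1) b x := by
  lift n to ℕ using hn
  simp only [Int.cast_natCast]
  exact ⟨jacobiP_natCast_add_one n a b x, jacobiP_natCast_sub_one n a b x⟩
end
end

section
/- Let a, b, c, d be real, let n ≥ k ≥ 0 be integers, and let (x,y) be real with x ≠ 1; write u(x,y) = P_{n,k}^{(a,b,c,d)}(x,y) and z = 1−x−y. Then ∂u/∂y = (k+b+c+1)·P_{n−1,k−1}^{(a,b+1,c+1,d)}(x,y), and (yc − zb)·u − yz·∂u/∂y = (k+1)·P_{n+1,k+1}^{(a,b−1,c−1,d)}(x,y). -/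
noncomputable section

/-- Four-parameter Koornwinder polynomial `P_{n,k}^{(a,b,c,d)}(x,y)`;
zero whenever `k < 0`, `n < 0`, or `k > n` (covering the conventions
`k = −1`, `n = −1`, `k = n+1`). -/
def koornP (n k : ℤ) (a b c d : ℝ) (x y : ℝ) : ℝ :=
  if n < 0 ∨ k < 0 ∨ n < k then 0 else
    jacobiP (n - k) (2 * (k : ℝ) + b + c + d + 1) a (2 * x - 1) *
      (1 - x) ^ k.toNat * jacobiP k c b (-1 + 2 * y / (1 - x))

/-- The homogeneous form `∑ C(α, i) C(β, j) B^i A^j` over `i + j = k`. -/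
def binomForm (α β : ℝ) (k : ℕ) (A B : ℝ) : ℝ :=
  ∑ p ∈ Finset.HasAntidiagonal.antidiagonal k, genBinom α p.1 * genBinom β p.2 * B ^ p.1 * A ^ p.2

/-- The sum of the two partial derivatives of `binomForm`. -/
def binomFormDeriv (α β : ℝ) (k : ℕ) (A B : ℝ) : ℝ :=
  ∑ p ∈ Finset.HasAntidiagonal.antidiagonal k, genBinom α p.1 * genBinom β p.2 *
    (p.1 * B ^ (p.1 - 1) * A ^ p.2 + p.2 * B ^ p.1 * A ^ (p.2 - 1))

theorem jacobiP_eq_binomForm (k : ℕ) (a b v : ℝ) :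
    jacobiP k a b (-1 + 2 * v) = binomForm (k + a) (k + b) k (v - 1) v := by
  have h : ¬ ((k : ℤ) < 0) := by omega
  rw [jacobiP, if_neg h, binomForm, ← Finset.Nat.sum_antidiagonal_swap,
    Finset.Nat.sum_antidiagonal_eq_sum_range_succ_mk]
  refine Finset.sum_congr (by simp) fun m _ => ?_
  simp only [Int.toNat_natCast, Int.cast_natCast, Prod.swap]
  rw [show (-1 + 2 * v - 1) / 2 = v - 1 by ring, show (-1 + 2 * v + 1) / 2 = v by ring]
  ring

theorem hasDerivAt_binomForm (α β : ℝ) (k : ℕ) (v : ℝ) :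
    HasDerivAt (fun v => binomForm α β k (v - 1) v) (binomFormDeriv α β k (v - 1) v) v := by
  unfold binomForm binomFormDeriv
  refine HasDerivAt.fun_sum fun p _ => ?_
  have h1 := (hasDerivAt_id v).pow p.1
  have h2 := ((hasDerivAt_id v).sub_const 1).pow p.2
  have h3 := (h1.const_mul (genBinom α p.1 * genBinom β p.2)).mul h2
  refine h3.congr_deriv ?_
  simp
  ring

theorem binomFormDeriv_zero (α β A B : ℝ) : binomFormDeriv α β 0 A B = 0 := by
  simp [binomFormDeriv]

theorem binomFormDeriv_succ (α β : ℝ) (k : ℕ) (A B : ℝ) :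
    binomFormDeriv α β (k + 1) A B = (α + β - k) * binomForm α β k A B := by
  simp only [binomFormDeriv, binomForm, mul_add, Finset.sum_add_distrib, Finset.mul_sum]
  rw [Finset.Nat.sum_antidiagonal_succ, Finset.Nat.sum_antidiagonal_succ']
  simp only [Nat.cast_zero, zero_mul, mul_zero, zero_add, add_tsub_cancel_right,
    ← Finset.sum_add_distrib]
  refine Finset.sum_congr rfl fun p hp => ?_
  have hk : (p.1 : ℝ) + p.2 = k := by exact_mod_cast Finset.HasAntidiagonal.mem_antidiagonal.mp hp
  push_cast
  linear_combination B ^ p.1 * A ^ p.2 * genBinom β p.2 * succ_mul_genBinom_succ α p.1 +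
    B ^ p.1 * A ^ p.2 * genBinom α p.1 * succ_mul_genBinom_succ β p.2 -
    genBinom α p.1 * genBinom β p.2 * B ^ p.1 * A ^ p.2 * hk

theorem succ_mul_binomForm_succ (α β : ℝ) (k : ℕ) (A B : ℝ) :
    ((k : ℝ) + 1) * binomForm α β (k + 1) A B =
      ((α - k) * B + (β - k) * A) * binomForm α β k A B + A * B * binomFormDeriv α β k A B := by
  have split : ((k : ℝ) + 1) * binomForm α β (k + 1) A B =
      ∑ p ∈ Finset.HasAntidiagonal.antidiagonal (k + 1),
        (p.1 : ℝ) * (genBinom α p.1 * genBinom β p.2 * B ^ p.1 * A ^ p.2) +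
      ∑ p ∈ Finset.HasAntidiagonal.antidiagonal (k + 1),
        (p.2 : ℝ) * (genBinom α p.1 * genBinom β p.2 * B ^ p.1 * A ^ p.2) := by
    rw [binomForm, Finset.mul_sum, ← Finset.sum_add_distrib]
    refine Finset.sum_congr rfl fun p hp => ?_
    have hk : (p.1 : ℝ) + p.2 = k + 1 := by exact_mod_cast Finset.HasAntidiagonal.mem_antidiagonal.mp hp
    rw [← hk, add_mul]
  rw [split, Finset.Nat.sum_antidiagonal_succ, Finset.Nat.sum_antidiagonal_succ']
  simp only [Nat.cast_zero, zero_mul, zero_add, binomForm, binomFormDeriv,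
    Finset.mul_sum, ← Finset.sum_add_distrib]
  refine Finset.sum_congr rfl fun p hp => ?_
  have hk : (p.1 : ℝ) + p.2 = k := by exact_mod_cast Finset.HasAntidiagonal.mem_antidiagonal.mp hp
  have pow_pred (t : ℝ) (i : ℕ) : (i : ℝ) * t ^ (i - 1) * t = i * t ^ i := by
    cases i with
    | zero => simp
    | succ i => simp [pow_succ, mul_assoc]
  push_cast
  linear_combination
    B ^ (p.1 + 1) * A ^ p.2 * genBinom β p.2 * succ_mul_genBinom_succ α p.1 +
    B ^ p.1 * A ^ (p.2 + 1) * genBinom α p.1 * succ_mul_genBinom_succ β p.2 -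
    genBinom α p.1 * genBinom β p.2 * A ^ (p.2 + 1) * pow_pred B p.1 -
    genBinom α p.1 * genBinom β p.2 * B ^ (p.1 + 1) * pow_pred A p.2 -
    genBinom α p.1 * genBinom β p.2 * B ^ p.1 * A ^ p.2 * (A + B) * hk

theorem koornP_eq_binomForm (a b c d : ℝ) (n : ℤ) (k : ℕ) (hnk : (k : ℤ) ≤ n) (x y : ℝ) :
    koornP n k a b c d x y = jacobiP (n - k) (2 * (k : ℝ) + b + c + d + 1) a (2 * x - 1) *
      (1 - x) ^ k * binomForm (k + c) (k + b) k (y / (1 - x) - 1) (y / (1 - x)) := by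
  rw [koornP, if_neg (by omega), mul_div_assoc, jacobiP_eq_binomForm, Int.toNat_natCast,
    Int.cast_natCast]

theorem hasDerivAt_koornP (a b c d : ℝ) (n : ℤ) (k : ℕ) (hnk : (k : ℤ) ≤ n) (x y : ℝ) :
    HasDerivAt (koornP n k a b c d x)
      (jacobiP (n - k) (2 * (k : ℝ) + b + c + d + 1) a (2 * x - 1) * (1 - x) ^ k *
        (binomFormDeriv (k + c) (k + b) k (y / (1 - x) - 1) (y / (1 - x)) * (1 / (1 - x)))) y := by
  rw [funext (koornP_eq_binomForm a b c d n k hnk x)]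
  exact ((hasDerivAt_binomForm (k + c) (k + b) k (y / (1 - x))).comp y
    ((hasDerivAt_id y).div_const (1 - x))).const_mul _

theorem koorn_ladder_M01 (a b c d : ℝ) (n k : ℤ) (hk : 0 ≤ k) (hnk : k ≤ n)
    (x y : ℝ) (hx : x ≠ 1) :
    deriv (koornP n k a b c d x) y
      = ((k : ℝ) + b + c + 1) * koornP (n - 1) (k - 1) a (b + 1) (c + 1) d x y ∧
    (y * c - (1 - x - y) * b) * koornP n k a b c d x y
        - y * (1 - x - y) * deriv (koornP n k a b c d x) y
      = ((k : ℝ) + 1) * koornP (n + 1) (k + 1) a (b - 1) (c - 1) d x y := by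
  have hs : 1 - x ≠ 0 := sub_ne_zero.mpr hx.symm
  lift k to ℕ using hk
  rw [(hasDerivAt_koornP a b c d n k hnk x y).deriv]
  refine ⟨?_, ?_⟩
  · cases k with
    | zero => simp [binomFormDeriv_zero, koornP]
    | succ k =>
      rw [show ((k + 1 : ℕ) : ℤ) - 1 = k by push_cast; ring,
        koornP_eq_binomForm _ _ _ _ _ _ (by push_cast at hnk; omega), binomFormDeriv_succ,
        show n - 1 - (k : ℤ) = n - ((k + 1 : ℕ) : ℤ) by push_cast; ring]
      push_cast
      rw [show 2 * (k : ℝ) + (b + 1) + (c + 1) + d + 1 = 2 * (k + 1) + b + c + d + 1 by ring,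
        show (k : ℝ) + (c + 1) = k + 1 + c by ring, show (k : ℝ) + (b + 1) = k + 1 + b by ring]
      field_simp
      ring
  · have key := succ_mul_binomForm_succ (k + c) (k + b) k (y / (1 - x) - 1) (y / (1 - x))
    rw [show (k : ℤ) + 1 = ((k + 1 : ℕ) : ℤ) by push_cast; ring,
      koornP_eq_binomForm _ _ _ _ _ _ hnk,
      koornP_eq_binomForm _ _ _ _ _ _ (by push_cast; omega),
      show n + 1 - ((k + 1 : ℕ) : ℤ) = n - k by push_cast; ring]
    push_cast
    rw [show 2 * ((k : ℝ) + 1) + (b - 1) + (c - 1) + d + 1 = 2 * k + b + c + d + 1 by ring,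
      show (k : ℝ) + 1 + (c - 1) = k + c by ring, show (k : ℝ) + 1 + (b - 1) = k + b by ring]
    generalize hv : y / (1 - x) = v at key ⊢
    have hy : y = v * (1 - x) := by rw [← hv, div_mul_cancel₀ _ hs]
    have hinv : (1 - x) * (1 / (1 - x)) = 1 := mul_one_div_cancel hs
    generalize binomFormDeriv _ _ _ _ _ = D at key ⊢
    generalize jacobiP _ _ _ _ = Q
    rw [hy]
    linear_combination (-Q * (1 - x) ^ (k + 1)) * key -
      v * (1 - v) * Q * (1 - x) ^ (k + 1) * D * hinv
end
end
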